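/- For every D > 2, every finite metric space (X,d) and every weight function w : X → (0,∞), there exists a subset S ⊆ X that embeds into an ultrametric space with distortion at most D and satisfies ∑_{x∈S} w(x)^θ(D) ≥ (∑_{x∈X} w(x))^θ(D), where θ(D) ∈ (0,1) is the unique solution of 2/D = (1−θ)θ^(θ/(1−θ)). -/

import Mathlib

/-- `ρ` is an ultrametric on the subset `S`. -/
def IsUltrametricOn {X : Type*} (ρ : X → X → ℝ) (S : Set X) : Prop :=
  (∀ x ∈ S, ∀ y ∈ S, ρ x y = ρ y x) ∧ (∀ x ∈ S, ρ x x = 0) ∧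
  (∀ x ∈ S, ∀ y ∈ S, x ≠ y → 0 < ρ x y) ∧
  (∀ x ∈ S, ∀ y ∈ S, ∀ z ∈ S, ρ x y ≤ max (ρ x z) (ρ z y))

open Finset in
/-- One step of weighted ball carving, with the set of centers restricted to `V`. -/
lemma nt_carve {X : Type*} [Fintype X] [MetricSpace X] [DecidableEq X]
    (w : X → ℝ) (hw : ∀ x, 0 < w x) (r R : ℝ) (hrR : r ≤ R) :
    ∀ (V A : Finset X) (a : X → ℝ), (∀ x, 0 ≤ a x) →
    ∃ (S : Finset X) (c : X → X), S ⊆ A ∧ (∀ x ∈ S, dist x (c x) ≤ r) ∧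
      (∀ x ∈ S, ∀ y ∈ S, c x ≠ c y → R - r < dist x y) ∧
      ∑ x ∈ A, a x * ((∑ y ∈ V with dist x y ≤ r, w y) / (∑ y ∈ V with dist x y ≤ R, w y))
        ≤ ∑ x ∈ S, a x := by
  intro V
  induction V using Finset.strongInduction with
  | H V ih =>
  intro A a ha
  rcases V.eq_empty_or_nonempty with hV | hV
  · subst hV
    exact ⟨∅, id, by simp, by simp, by simp, by simp⟩
  set q : X → ℝ := fun x =>
    (∑ y ∈ V with dist x y ≤ r, w y) / (∑ y ∈ V with dist x y ≤ R, w y) with hq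
  have hq0 : ∀ x, 0 ≤ q x := fun x =>
    div_nonneg (sum_nonneg fun y _ => (hw y).le) (sum_nonneg fun y _ => (hw y).le)
  have hWpos : 0 < ∑ v ∈ V, w v := sum_pos (fun v _ => hw v) hV
  -- averaging
  have key : ∀ x, ∑ v ∈ V, w v * ((if dist x v ≤ r then (1:ℝ) else 0) +
      (if dist x v ≤ R then 0 else q x)) = (∑ v ∈ V, w v) * q x := by
    intro x
    have h1 : ∑ v ∈ V, w v * (if dist x v ≤ r then (1:ℝ) else 0)
        = ∑ y ∈ V with dist x y ≤ r, w y := by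
      rw [sum_filter]; exact sum_congr rfl fun v _ => by split_ifs <;> simp
    have h2 : ∑ v ∈ V, w v * (if dist x v ≤ R then 0 else q x)
        = (∑ v ∈ V, w v) * q x - (∑ y ∈ V with dist x y ≤ R, w y) * q x := by
      rw [sum_filter, sum_mul, sum_mul, ← sum_sub_distrib]
      exact sum_congr rfl fun v _ => by split_ifs <;> simp
    have h3 : (∑ y ∈ V with dist x y ≤ R, w y) * q x = ∑ y ∈ V with dist x y ≤ r, w y := by
      by_cases h0 : (∑ y ∈ V with dist x y ≤ R, w y) = 0
      · have : (∑ y ∈ V with dist x y ≤ r, w y) ≤ ∑ y ∈ V with dist x y ≤ R, w y := by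
          apply sum_le_sum_of_subset_of_nonneg
          · intro y hy
            simp only [mem_filter] at hy ⊢
            exact ⟨hy.1, hy.2.trans hrR⟩
          · intro y _ _; exact (hw y).le
        have h' : 0 ≤ (∑ y ∈ V with dist x y ≤ r, w y) := sum_nonneg fun y _ => (hw y).le
        rw [h0, zero_mul]; linarith
      · simp only [hq]; field_simp
    simp only [mul_add, sum_add_distrib]
    rw [h1, h2, h3]; ring
  have hex : ∃ v ∈ V, ∑ x ∈ A, a x * q x ≤ ∑ x ∈ A, a x * ((if dist x v ≤ r then (1:ℝ) else 0) +
      (if dist x v ≤ R then 0 else q x)) := by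
    by_contra hcon
    push Not at hcon
    have h1 : ∑ v ∈ V, w v * (∑ x ∈ A, a x * ((if dist x v ≤ r then (1:ℝ) else 0) +
      (if dist x v ≤ R then 0 else q x))) < ∑ v ∈ V, w v * (∑ x ∈ A, a x * q x) :=
      sum_lt_sum_of_nonempty hV fun v hv => mul_lt_mul_of_pos_left (hcon v hv) (hw v)
    have h2 : ∑ v ∈ V, w v * (∑ x ∈ A, a x * ((if dist x v ≤ r then (1:ℝ) else 0) +
      (if dist x v ≤ R then 0 else q x))) = ∑ v ∈ V, w v * (∑ x ∈ A, a x * q x) := by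
      simp only [mul_sum]
      rw [sum_comm, sum_comm (s := V)]
      refine sum_congr rfl fun x _ => ?_
      have := key x
      calc _ = a x * ∑ v ∈ V, w v * ((if dist x v ≤ r then (1:ℝ) else 0) +
                (if dist x v ≤ R then 0 else q x)) := by
              rw [mul_sum]; exact sum_congr rfl fun v _ => by ring
        _ = _ := by
              rw [this, sum_mul, mul_sum]; exact sum_congr rfl fun v _ => by ring
    linarith
  obtain ⟨v, hv, hle⟩ := hex
  obtain ⟨S', c', hS'A, hd', hg', hs'⟩ := ih (V.erase v) (erase_ssubset hv)
    (A.filter fun x => ¬ dist x v ≤ R) a ha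
  have hS'far : ∀ y ∈ S', R < dist y v := by
    intro y hy
    have := hS'A hy
    simp only [mem_filter, not_le] at this
    exact this.2
  refine ⟨(A.filter fun x => dist x v ≤ r) ∪ S', fun x => if dist x v ≤ r then v else c' x,
    ?_, ?_, ?_, ?_⟩
  · exact union_subset (filter_subset _ _) (hS'A.trans (filter_subset _ _))
  · intro x hx
    rcases mem_union.1 hx with h | h
    · have := (mem_filter.1 h).2
      simp [this]
    · have h1 : ¬ dist x v ≤ r := by have := hS'far x h; linarith
      simp only [h1, if_false]; exact hd' x h
  · intro x hx y hy hne
    by_cases hxr : dist x v ≤ r <;> by_cases hyr : dist y v ≤ r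
    · simp [hxr, hyr] at hne
    · have hyS : y ∈ S' := by
        rcases mem_union.1 hy with h | h
        · exact absurd (mem_filter.1 h).2 hyr
        · exact h
      have := hS'far y hyS
      have := dist_triangle y x v
      rw [dist_comm y x] at this
      linarith
    · have hxS : x ∈ S' := by
        rcases mem_union.1 hx with h | h
        · exact absurd (mem_filter.1 h).2 hxr
        · exact h
      have := hS'far x hxS
      have := dist_triangle x y v
      linarith
    · have hyS : y ∈ S' := by
        rcases mem_union.1 hy with h | h
        · exact absurd (mem_filter.1 h).2 hyr
        · exact h
      have hxS : x ∈ S' := by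
        rcases mem_union.1 hx with h | h
        · exact absurd (mem_filter.1 h).2 hxr
        · exact h
      simp only [hxr, hyr, if_false] at hne
      exact hg' x hxS y hyS hne
  · have hdisj : Disjoint (A.filter fun x => dist x v ≤ r) S' := by
      rw [disjoint_left]
      intro x hx hx'
      have := hS'far x hx'
      have := (mem_filter.1 hx).2
      linarith
    rw [sum_union hdisj]
    refine hle.trans ?_
    simp only [mul_add, sum_add_distrib]
    apply add_le_add
    · rw [sum_filter]
      exact le_of_eq (sum_congr rfl fun x _ => by split_ifs <;> simp)
    · refine le_trans (le_of_eq ?_) hs'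
      rw [sum_filter]
      refine sum_congr rfl fun x _ => ?_
      by_cases hxR : dist x v ≤ R
      · simp [hxR]
      · have hxr : ¬ dist x v ≤ r := by linarith
        simp only [hxR, if_false, not_false_eq_true, if_true, hq]
        have e1 : (V.filter fun y => dist x y ≤ r) = ((V.erase v).filter fun y => dist x y ≤ r) := by
          ext y; simp only [mem_filter, mem_erase]
          constructor
          · rintro ⟨h1, h2⟩; exact ⟨⟨fun h => hxr (h ▸ h2), h1⟩, h2⟩
          · rintro ⟨⟨_, h1⟩, h2⟩; exact ⟨h1, h2⟩
        have e2 : (V.filter fun y => dist x y ≤ R) = ((V.erase v).filter fun y => dist x y ≤ R) := by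
          ext y; simp only [mem_filter, mem_erase]
          constructor
          · rintro ⟨h1, h2⟩; exact ⟨⟨fun h => hxR (h ▸ h2), h1⟩, h2⟩
          · rintro ⟨⟨_, h1⟩, h2⟩; exact ⟨h1, h2⟩
        rw [e1, e2]

open Finset in
/-- Iterated fragmentation. -/
lemma nt_iter {X : Type*} [Fintype X] [MetricSpace X] [DecidableEq X]
    (w : X → ℝ) (hw : ∀ x, 0 < w x) (r R : ℕ → ℝ) (hrR : ∀ n, r n ≤ R n) (N : ℕ) :
    ∀ (a : X → ℝ), (∀ x, 0 ≤ a x) →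
    ∃ (S : Finset X) (c : ℕ → X → X), (∀ n < N, ∀ x ∈ S, dist x (c n x) ≤ r n) ∧
      (∀ n < N, ∀ x ∈ S, ∀ y ∈ S, c n x ≠ c n y → R n - r n < dist x y) ∧
      (∀ n, N ≤ n → c n = id) ∧
      ∑ x, a x * ∏ n ∈ range N,
        ((∑ y with dist x y ≤ r n, w y) / (∑ y with dist x y ≤ R n, w y))
        ≤ ∑ x ∈ S, a x := by
  induction N with
  | zero => intro a ha; exact ⟨univ, fun _ => id, by simp, by simp, by simp, by simp⟩
  | succ N ih =>
    intro a ha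
    set q : X → ℝ := fun x =>
      (∑ y with dist x y ≤ r N, w y) / (∑ y with dist x y ≤ R N, w y) with hq
    have hq0 : ∀ x, 0 ≤ q x := fun x =>
      div_nonneg (sum_nonneg fun y _ => (hw y).le) (sum_nonneg fun y _ => (hw y).le)
    obtain ⟨S, c, h1, h2, h3, h4⟩ := ih (fun x => a x * q x) fun x => mul_nonneg (ha x) (hq0 x)
    obtain ⟨T, k, hTS, hk1, hk2, hk3⟩ := nt_carve w hw (r N) (R N) (hrR N) univ S a ha
    refine ⟨T, Function.update c N k, ?_, ?_, ?_, ?_⟩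
    · intro n hn x hx
      by_cases hnN : n = N
      · subst hnN; simpa using hk1 x hx
      · simpa [hnN] using h1 n (by omega) x (hTS hx)
    · intro n hn x hx y hy hne
      by_cases hnN : n = N
      · subst hnN; exact hk2 x hx y hy (by simpa using hne)
      · exact h2 n (by omega) x (hTS hx) y (hTS hy) (by simpa [hnN] using hne)
    · intro n hn
      have hnN : n ≠ N := by omega
      rw [Function.update_of_ne hnN]
      exact h3 n (by omega)
    · refine le_trans (le_of_eq ?_) (h4.trans hk3)
      refine sum_congr rfl fun x _ => ?_
      rw [prod_range_succ]
      simp only [hq]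
      ring

open Finset in
/-- Averaging over a random shift of the scales. -/
lemma nt_shift (F : ℝ → ℝ) (hF : Monotone F) (A B β : ℝ) (hβ0 : 0 < β) (hβ1 : β < 1) (N : ℕ)
    (hB : ∀ t, 0 ≤ t → F t = B) (hA : ∀ t, t ≤ -(N:ℝ) + 1 → F t = A) :
    ∃ s ∈ Set.Icc (0:ℝ) 1,
      ∑ n ∈ range N, (F (s - n - 1 + β) - F (s - n - 1)) ≤ β * (B - A) := by
  have hint : ∀ a b, IntervalIntegrable F MeasureTheory.volume a b :=
    fun a b => hF.intervalIntegrable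
  have hintc : ∀ d a b, IntervalIntegrable (fun s => F (s + d)) MeasureTheory.volume a b :=
    fun d a b => Monotone.intervalIntegrable fun x y h => hF (by linarith)
  by_contra hcon
  push Not at hcon
  have e : ∀ s : ℝ, ∑ n ∈ range N, (F (s - n - 1 + β) - F (s - n - 1))
      = ∑ n ∈ range N, (F (s + (β - n - 1)) - F (s + (-n - 1))) := by
    intro s
    refine sum_congr rfl fun n _ => ?_
    congr 2 <;> ring
  have hI : IntervalIntegrable
      (fun s : ℝ => ∑ n ∈ range N, (F (s + (β - n - 1)) - F (s + (-n - 1))))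
      MeasureTheory.volume 0 1 := by
    have := IntervalIntegrable.sum (μ := MeasureTheory.volume) (a := 0) (b := 1) (range N)
      (f := fun (n : ℕ) (s : ℝ) => F (s + (β - n - 1)) - F (s + (-n - 1)))
      (fun n _ => (hintc _ _ _).sub (hintc _ _ _))
    have e2 : (fun s : ℝ => ∑ n ∈ range N, (F (s + (β - n - 1)) - F (s + (-n - 1))))
        = ∑ n ∈ range N, (fun s : ℝ => F (s + (β - n - 1)) - F (s + (-n - 1))) := by
      ext s; simp
    rw [e2]; exact this
  have hval : ∫ s in (0:ℝ)..1, ∑ n ∈ range N, (F (s + (β - n - 1)) - F (s + (-n - 1)))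
      = β * (B - A) := by
    rw [intervalIntegral.integral_finsetSum (fun n _ => (hintc _ _ _).sub (hintc _ _ _))]
    have h1 : ∀ n : ℕ, ∫ s in (0:ℝ)..1, (F (s + (β - n - 1)) - F (s + (-n - 1)))
        = (∫ t in (-(n:ℝ))..(-(n:ℝ)+β), F t) - ∫ t in (-((n+1:ℕ):ℝ))..(-((n+1:ℕ):ℝ)+β), F t := by
      intro n
      rw [intervalIntegral.integral_sub (hintc _ _ _) (hintc _ _ _),
        intervalIntegral.integral_comp_add_right, intervalIntegral.integral_comp_add_right]
      have a1 := intervalIntegral.integral_add_adjacent_intervals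
        (hint (-((n+1:ℕ):ℝ)) (-((n+1:ℕ):ℝ)+β)) (hint (-((n+1:ℕ):ℝ)+β) (-(n:ℝ)+β))
      have a2 := intervalIntegral.integral_add_adjacent_intervals
        (hint (-((n+1:ℕ):ℝ)) (-(n:ℝ))) (hint (-(n:ℝ)) (-(n:ℝ)+β))
      have b1 : 0 + (β - n - 1) = -((n+1:ℕ):ℝ)+β := by push_cast; ring
      have b2 : 1 + (β - n - 1) = -(n:ℝ)+β := by ring
      have b3 : 0 + (-(n:ℝ) - 1) = -((n+1:ℕ):ℝ) := by push_cast; ring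
      have b4 : 1 + (-(n:ℝ) - 1) = -(n:ℝ) := by ring
      rw [b1, b2, b3, b4]
      linarith
    simp only [h1]
    rw [sum_range_sub' (fun n : ℕ => ∫ t in (-(n:ℝ))..(-(n:ℝ)+β), F t)]
    have c1 : ∫ t in (-((0:ℕ):ℝ))..(-((0:ℕ):ℝ)+β), F t = β * B := by
      have : ∫ t in (-((0:ℕ):ℝ))..(-((0:ℕ):ℝ)+β), F t = ∫ t in (-((0:ℕ):ℝ))..(-((0:ℕ):ℝ)+β), B := by
        apply intervalIntegral.integral_congr
        intro t ht
        rw [Set.uIcc_of_le (by linarith)] at ht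
        exact hB t (by simpa using ht.1)
      rw [this]; simp
    have c2 : ∫ t in (-(N:ℝ))..(-(N:ℝ)+β), F t = β * A := by
      have : ∫ t in (-(N:ℝ))..(-(N:ℝ)+β), F t = ∫ t in (-(N:ℝ))..(-(N:ℝ)+β), A := by
        apply intervalIntegral.integral_congr
        intro t ht
        rw [Set.uIcc_of_le (by linarith)] at ht
        exact hA t (by linarith [ht.2])
      rw [this]; simp
    rw [c1, c2]; ring
  have hmem : ∫ s in (0:ℝ)..1, (∑ n ∈ range N, (F (s + (β - n - 1)) - F (s + (-n - 1)))
      - β * (B - A)) = 0 := by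
    rw [intervalIntegral.integral_sub hI (by simp), hval]; simp
  have hpos : 0 < ∫ s in (0:ℝ)..1, (∑ n ∈ range N, (F (s + (β - n - 1)) - F (s + (-n - 1)))
      - β * (B - A)) := by
    apply intervalIntegral.intervalIntegral_pos_of_pos_on (hI.sub (by simp))
    · intro s hs
      have := hcon s ⟨hs.1.le, hs.2.le⟩
      rw [e s] at this
      linarith
    · norm_num
  linarith

/-- The ultrametric attached to a sequence of cluster maps. -/
lemma nt_ultra {X : Type*} [MetricSpace X] (D δ u r0 : ℝ) (hδ : 0 < δ) (hδD : δ * D = 2)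
    (hD : 0 < D)
    (hu0 : 0 < u) (hu1 : u < 1) (hr0 : 0 < r0) (hdiam : ∀ x y : X, dist x y ≤ 2 * r0)
    (S : Finset X) (c : ℕ → X → X) (N : ℕ)
    (h1 : ∀ n, ∀ x ∈ S, dist x (c n x) ≤ r0 * u ^ (n + 1))
    (h2 : ∀ n, ∀ x ∈ S, ∀ y ∈ S, c n x ≠ c n y → δ * (r0 * u ^ n) ≤ dist x y)
    (h3 : c N = id) :
    ∃ ρ : X → X → ℝ, IsUltrametricOn ρ (S : Set X) ∧
      (∀ x ∈ S, ∀ y ∈ S, dist x y ≤ ρ x y ∧ ρ x y ≤ D * dist x y) := by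
  classical
  let f : X → (∀ _ : ℕ, X) := fun x n => c n x
  have hf : ∀ x y, x ≠ y → f x ≠ f y := by
    intro x y hxy h
    have := congrFun h N
    simp only [f, h3] at this
    exact hxy this
  let ρ : X → X → ℝ := fun x y => if x = y then 0 else 2 * (r0 * u ^ (PiNat.firstDiff (f x) (f y)))
  have hρ : ∀ x y, x ≠ y → ρ x y = 2 * (r0 * u ^ (PiNat.firstDiff (f x) (f y))) :=
    fun x y h => by simp [ρ, h]
  have hρ0 : ∀ x, ρ x x = 0 := fun x => by simp [ρ]
  have hρnn : ∀ x y, 0 ≤ ρ x y := by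
    intro x y
    simp only [ρ]; split_ifs
    · exact le_rfl
    · positivity
  refine ⟨ρ, ⟨?_, ?_, ?_, ?_⟩, ?_⟩
  · intro x _ y _
    by_cases h : x = y
    · rw [h]
    · rw [hρ x y h, hρ y x (Ne.symm h), PiNat.firstDiff_comm]
  · intro x _; exact hρ0 x
  · intro x _ y _ h
    rw [hρ x y h]; positivity
  · intro x _ y _ z _
    by_cases hxy : x = y
    · rw [hxy, hρ0]; exact le_max_of_le_left (hρnn _ _)
    by_cases hxz : x = z
    · rw [hxz]; exact le_max_right _ _
    by_cases hzy : z = y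
    · rw [hzy]; exact le_max_left _ _
    rw [hρ x y hxy, hρ x z hxz, hρ z y hzy]
    have := PiNat.min_firstDiff_le (f x) (f z) (f y) (hf x y hxy)
    rcases min_le_iff.1 this with h | h
    · apply le_max_of_le_left
      have := pow_le_pow_of_le_one hu0.le hu1.le h
      gcongr
    · apply le_max_of_le_right
      have := pow_le_pow_of_le_one hu0.le hu1.le h
      gcongr
  · intro x hx y hy
    by_cases hxy : x = y
    · subst hxy; simp [hρ0]
    rw [hρ x y hxy]
    have hne : c (PiNat.firstDiff (f x) (f y)) x ≠ c (PiNat.firstDiff (f x) (f y)) y :=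
      PiNat.apply_firstDiff_ne (hf x y hxy)
    have hlt : ∀ m, m < PiNat.firstDiff (f x) (f y) → c m x = c m y :=
      fun m hm => PiNat.apply_eq_of_lt_firstDiff hm
    generalize PiNat.firstDiff (f x) (f y) = n at hne hlt
    constructor
    · rcases n with _ | m
      · simpa using hdiam x y
      · have e := hlt m (by omega)
        have a1 := h1 m x hx
        have a2 := h1 m y hy
        have := dist_triangle_right x y (c m x)
        rw [e] at this a1
        linarith
    · have := h2 n x hx y hy hne
      calc 2 * (r0 * u ^ n) = D * (δ * (r0 * u ^ n)) := by rw [← hδD]; ring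
        _ ≤ _ := by gcongr

/-- For every `D > 2`, every finite metric space `(X,d)` and every weight
`w : X → (0,∞)`, there is `S ⊆ X` embedding into an ultrametric space with distortion `D`
and `∑_{x∈S} w(x)^θ(D) ≥ (∑_{x∈X} w(x))^θ(D)`, where `θ(D) ∈ (0,1)` is the unique solution
of `2/D = (1−θ)θ^(θ/(1−θ))`. -/
theorem stmt14 {X : Type*} [Fintype X] [MetricSpace X]
    (D θ : ℝ) (hD : 2 < D) (hθ : θ ∈ Set.Ioo (0 : ℝ) 1)
    (hθD : 2 / D = (1 - θ) * θ ^ (θ / (1 - θ)))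
    (w : X → ℝ) (hw : ∀ x, 0 < w x) :
    ∃ S : Finset X, ∃ ρ : X → X → ℝ,
      IsUltrametricOn ρ (S : Set X) ∧
      (∀ x ∈ S, ∀ y ∈ S, dist x y ≤ ρ x y ∧ ρ x y ≤ D * dist x y) ∧
      (∑ x : X, w x) ^ θ ≤ ∑ x ∈ S, w x ^ θ := by
  classical
  obtain ⟨hθ0, hθ1⟩ := hθ
  rcases isEmpty_or_nonempty X with hX | hX
  · refine ⟨∅, fun _ _ => 0, ⟨by simp, by simp, by simp, by simp⟩, by simp, ?_⟩
    simp [Real.zero_rpow hθ0.ne']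
  have hθ1' : 0 < 1 - θ := by linarith
  set u : ℝ := θ ^ (1 / (1 - θ)) with hu
  have hu0 : 0 < u := Real.rpow_pos_of_pos hθ0 _
  have hu1 : u < 1 := Real.rpow_lt_one hθ0.le hθ1 (by positivity)
  set δ : ℝ := 2 / D with hδ
  have hD0 : 0 < D := by linarith
  have hδ0 : 0 < δ := by positivity
  have hδ1 : δ < 1 := by rw [hδ, div_lt_one hD0]; exact hD
  have hδD : δ * D = 2 := by rw [hδ]; field_simp
  have hδu : u ^ θ - u = δ := by
    have h1 : u ^ θ = θ ^ (θ / (1 - θ)) := by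
      rw [hu, ← Real.rpow_mul hθ0.le]; congr 1; ring
    have h2 : u = θ * θ ^ (θ / (1 - θ)) := by
      have : (1 / (1 - θ)) = 1 + θ / (1 - θ) := by field_simp; ring
      rw [hu, this, Real.rpow_add hθ0, Real.rpow_one]
    rw [h1, hθD]; linarith [h2]
  -- geometry
  obtain ⟨M, hM0, hM⟩ : ∃ M : ℝ, 0 < M ∧ ∀ x y : X, dist x y ≤ M := by
    obtain ⟨C, hC⟩ := (Set.finite_range fun p : X × X => dist p.1 p.2).bddAbove
    exact ⟨max C 1, by positivity, fun x y => le_max_of_le_left (hC ⟨(x, y), rfl⟩)⟩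
  obtain ⟨m, hm0, hm⟩ : ∃ m : ℝ, 0 < m ∧ ∀ x y : X, x ≠ y → m ≤ dist x y := by
    obtain ⟨p, hp⟩ := Finite.exists_min
      (fun p : X × X => if p.1 = p.2 then (1:ℝ) else dist p.1 p.2)
    refine ⟨if p.1 = p.2 then (1:ℝ) else dist p.1 p.2, ?_, fun x y h => ?_⟩
    rotate_left
    · have := hp (x, y)
      simp only [h, if_false] at this
      exact this
    · split_ifs with h
      · norm_num
      · exact dist_pos.2 h
  obtain ⟨K, hK⟩ : ∃ K : ℕ, M * u ^ K < m := by
    obtain ⟨K, hK⟩ := exists_pow_lt_of_lt_one (div_pos hm0 hM0) hu1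
    exact ⟨K, by rw [lt_div_iff₀ hM0] at hK; linarith⟩
  set N := K + 1 with hN
  set W := ∑ x : X, w x with hW
  have hW0 : 0 < W := Finset.sum_pos (fun x _ => hw x) Finset.univ_nonempty
  let rad : ℝ → ℝ := fun t => M * u ^ (-t)
  have hrad : Monotone rad := by
    intro s t h
    have := Real.rpow_le_rpow_of_exponent_ge hu0 hu1.le (neg_le_neg h)
    simp only [rad]; gcongr
  have hrad0 : ∀ t, 0 < rad t := fun t => mul_pos hM0 (Real.rpow_pos_of_pos hu0 _)
  let b : X → ℝ → ℝ := fun x t => ∑ y with dist x y ≤ rad t, w y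
  have hb0 : ∀ x t, 0 < b x t := by
    intro x t
    refine Finset.sum_pos (fun y _ => hw y) ⟨x, ?_⟩
    simp [(hrad0 t).le]
  have hbm : ∀ x, Monotone (b x) := by
    intro x s t h
    apply Finset.sum_le_sum_of_subset_of_nonneg
    · intro y hy
      simp only [Finset.mem_filter] at hy ⊢
      exact ⟨hy.1, hy.2.trans (hrad h)⟩
    · intro y _ _; exact (hw y).le
  have hbtop : ∀ x t, 0 ≤ t → b x t = W := by
    intro x t ht
    have h0 : rad 0 = M := by simp [rad]
    have : ∀ y, dist x y ≤ rad t := fun y => (hM x y).trans (h0 ▸ hrad ht)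
    simp [b, this, hW]
  have hbbot : ∀ x t, t ≤ -(N:ℝ) + 1 → b x t = w x := by
    intro x t ht
    have h0 : rad (-(N:ℝ) + 1) = M * u ^ K := by
      simp only [rad, hN]
      rw [← Real.rpow_natCast]; congr 2; push_cast; ring
    have h1 : rad t < m := (hrad ht).trans_lt (h0 ▸ hK)
    have : (Finset.univ.filter fun y => dist x y ≤ rad t) = {x} := by
      ext y
      simp only [Finset.mem_filter, Finset.mem_univ, true_and, Finset.mem_singleton]
      constructor
      · intro h
        by_contra hne
        have := hm x y (Ne.symm hne)
        linarith
      · rintro rfl; simp [(hrad0 t).le]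
    simp only [b, this, Finset.sum_singleton]
  -- averaging over scales
  have hFmono : Monotone (fun t => ∑ x, w x / W * Real.log (b x t)) := by
    intro s t h
    apply Finset.sum_le_sum
    intro x _
    have := Real.log_le_log (hb0 x s) (hbm x h)
    have := (div_pos (hw x) hW0).le
    gcongr
  have hp1 : ∑ x, w x / W = 1 := by rw [← Finset.sum_div, ← hW, div_self hW0.ne']
  obtain ⟨s, ⟨hs0, hs1⟩, hs⟩ := nt_shift (fun t => ∑ x, w x / W * Real.log (b x t)) hFmono
    (∑ x, w x / W * Real.log (w x)) (Real.log W) (1 - θ) hθ1' (by linarith) N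
    (fun t ht => by
      simp only [hbtop _ t ht]
      rw [← Finset.sum_mul, hp1, one_mul])
    (fun t ht => by simp only [hbbot _ t ht])
  -- the fragmentation
  obtain ⟨S, c, hc1, hc2, hc3, hsum⟩ := nt_iter w hw (fun n => rad (s - n - 1))
    (fun n => rad (s - n - 1 + (1 - θ))) (fun n => hrad (by linarith)) N (fun x => w x ^ θ)
    (fun x => (Real.rpow_pos_of_pos (hw x) _).le)
  have hr1 : ∀ n : ℕ, rad (s - n - 1) = rad s * u ^ (n + 1) := by
    intro n
    simp only [rad]
    rw [mul_assoc, ← Real.rpow_natCast, ← Real.rpow_add hu0]; congr 2; push_cast; ring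
  have hr2 : ∀ n : ℕ, rad (s - n - 1 + (1 - θ)) = rad s * u ^ n * u ^ θ := by
    intro n
    simp only [rad]
    rw [mul_assoc, mul_assoc, ← Real.rpow_natCast, ← Real.rpow_add hu0, ← Real.rpow_add hu0]
    congr 2; ring
  have hgap : ∀ n : ℕ, rad (s - n - 1 + (1 - θ)) - rad (s - n - 1) = δ * (rad s * u ^ n) := by
    intro n; rw [hr1, hr2, ← hδu]; ring
  have hdiam : ∀ x y : X, dist x y ≤ 2 * rad s := by
    intro x y
    have h0 : rad 0 = M := by simp [rad]
    have := hrad hs0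
    have := hM x y
    linarith
  obtain ⟨ρ, hρ1, hρ2⟩ := nt_ultra D δ u (rad s) hδ0 hδD hD0 hu0 hu1 (hrad0 s) hdiam S c N
    (by
      intro n x hx
      by_cases hn : n < N
      · rw [← hr1]; exact hc1 n hn x hx
      · rw [hc3 n (by omega)]
        have := hrad0 s
        simp only [id, dist_self]; positivity)
    (by
      intro n x hx y hy hne
      by_cases hn : n < N
      · rw [← hgap]; exact (hc2 n hn x hx y hy hne).le
      · rw [hc3 n (by omega)] at hne
        have h1 := hm x y hne
        have h2 : rad s * u ^ n ≤ M * u ^ K := by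
          have a1 : rad s ≤ rad 1 := hrad hs1
          have a2 : u ^ n ≤ u ^ (K + 1) := pow_le_pow_of_le_one hu0.le hu1.le (by omega)
          have a3 : rad 1 * u ^ (K + 1) = M * u ^ K := by
            simp only [rad, Real.rpow_neg_one, pow_succ]; field_simp
          rw [← a3]
          have := hrad0 s
          have := hrad0 1
          gcongr
        have h3 : 0 < rad s * u ^ n := mul_pos (hrad0 s) (by positivity)
        nlinarith)
    (hc3 N le_rfl)
  refine ⟨S, ρ, hρ1, hρ2, le_trans ?_ hsum⟩
  -- the final inequality
  have hq : ∀ x, ∏ n ∈ Finset.range N, (b x (s - n - 1) / b x (s - n - 1 + (1 - θ)))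
      = Real.exp (-∑ n ∈ Finset.range N,
        (Real.log (b x (s - n - 1 + (1 - θ))) - Real.log (b x (s - n - 1)))) := by
    intro x
    rw [← Finset.sum_neg_distrib, Real.exp_sum]
    refine Finset.prod_congr rfl fun n _ => ?_
    rw [neg_sub, Real.exp_sub, Real.exp_log (hb0 _ _), Real.exp_log (hb0 _ _)]
  change W ^ θ ≤ ∑ x, w x ^ θ * ∏ n ∈ Finset.range N,
    (b x (s - n - 1) / b x (s - n - 1 + (1 - θ)))
  simp only [hq]
  set G : X → ℝ := fun x => ∑ n ∈ Finset.range N,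
        (Real.log (b x (s - n - 1 + (1 - θ))) - Real.log (b x (s - n - 1))) with hG
  have hGs : ∑ x, w x / W * G x
      ≤ (1 - θ) * (Real.log W - ∑ x, w x / W * Real.log (w x)) := by
    refine le_trans (le_of_eq ?_) hs
    simp only [hG, Finset.mul_sum]
    rw [Finset.sum_comm]
    refine Finset.sum_congr rfl fun n _ => ?_
    rw [← Finset.sum_sub_distrib]
    exact Finset.sum_congr rfl fun x _ => by ring
  have hterm : ∀ x, W ^ θ * (w x / W * (1 + ((1 - θ) * (Real.log W - Real.log (w x)) - G x)))
      ≤ w x ^ θ * Real.exp (-G x) := by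
    intro x
    have h1 := Real.add_one_le_exp ((1 - θ) * (Real.log W - Real.log (w x)) - G x)
    have h2 : W ^ θ * (w x / W * Real.exp ((1 - θ) * (Real.log W - Real.log (w x)) - G x))
        = w x ^ θ * Real.exp (-G x) := by
      have e1 : W ^ θ = Real.exp (Real.log W * θ) := Real.rpow_def_of_pos hW0 θ
      have e2 : w x ^ θ = Real.exp (Real.log (w x) * θ) := Real.rpow_def_of_pos (hw x) θ
      have e3 : w x / W = Real.exp (Real.log (w x) - Real.log W) := by
        rw [Real.exp_sub, Real.exp_log (hw x), Real.exp_log hW0]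
      rw [e1, e2, e3, ← Real.exp_add, ← Real.exp_add, ← Real.exp_add]
      congr 1; ring
    rw [← h2]
    have h3 : 0 < W ^ θ := Real.rpow_pos_of_pos hW0 _
    have h4 : 0 < w x / W := div_pos (hw x) hW0
    rw [add_comm] at h1
    gcongr
  refine le_trans ?_ (Finset.sum_le_sum fun x _ => hterm x)
  rw [← Finset.mul_sum]
  have h3 : 0 < W ^ θ := Real.rpow_pos_of_pos hW0 _
  apply le_mul_of_one_le_right h3.le
  have : ∑ x, w x / W * (1 + ((1 - θ) * (Real.log W - Real.log (w x)) - G x))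
      = 1 + ((1 - θ) * (Real.log W - ∑ x, w x / W * Real.log (w x)) - ∑ x, w x / W * G x) := by
    calc _ = ∑ x, (w x / W + ((1 - θ) * (w x / W * Real.log W)
              - (1 - θ) * (w x / W * Real.log (w x)) - w x / W * G x)) :=
            Finset.sum_congr rfl fun x _ => by ring
      _ = _ := by
        rw [Finset.sum_add_distrib, Finset.sum_sub_distrib, Finset.sum_sub_distrib,
          ← Finset.mul_sum, ← Finset.mul_sum, ← Finset.sum_mul, hp1]
        ring
  rw [this]
  linarith
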